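/- In a weak Hopf algebra H, the identity h_(1) S(h_(2)) h_(3) = h holds for all h ∈ H, and moreover the elements h_(1)S(h_(2)) and S(k_(1))k_(2) commute for all h, k ∈ H; consequently every weak Hopf algebra is a quantum inverse semigroup. -/

import Mathlib

open TensorProduct

/-- The convolution product on `End_k(H)`: `(f ∗ g)(h) = f(h₍₁₎) · g(h₍₂₎)`. -/
noncomputable def convProd {k H : Type*} [CommRing k] [Ring H] [Algebra k H]
    (Δ : H →ₗ[k] H ⊗[k] H) (f g : H →ₗ[k] H) : H →ₗ[k] H :=
  (LinearMap.mul' k H) ∘ₗ (TensorProduct.map f g) ∘ₗ Δ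

section WeakHopf

open Coalgebra WithConv

/-- A weak Hopf algebra structure with antipode `S` on an algebra that is also a coalgebra. -/
structure IsWeakHopf {k H : Type*} [CommRing k] [Ring H] [Algebra k H] [Coalgebra k H]
    (S : H →ₗ[k] H) : Prop where
  comul_mul : ∀ x y : H, comul (R := k) (x * y) = comul x * comul y
  counit_mul_fst_snd : ∀ h c l : H, counit (R := k) (h * c * l) =
    LinearMap.mul' k k ((TensorProduct.map (counit ∘ₗ LinearMap.mulLeft k h)
      (counit ∘ₗ LinearMap.mulRight k l)) (comul c))
  counit_mul_snd_fst : ∀ h c l : H, counit (R := k) (h * c * l) =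
    LinearMap.mul' k k ((TensorProduct.map (counit ∘ₗ LinearMap.mulRight k l)
      (counit ∘ₗ LinearMap.mulLeft k h)) (comul c))
  id_mul_antipode : ∀ h : H,
    LinearMap.mul' k H ((TensorProduct.map LinearMap.id S) (comul h)) =
      TensorProduct.lift ((LinearMap.lsmul k H) ∘ₗ (counit ∘ₗ LinearMap.mulRight k h)) (comul 1)
  antipode_mul_id : ∀ h : H,
    LinearMap.mul' k H ((TensorProduct.map S LinearMap.id) (comul h)) =
      TensorProduct.lift ((LinearMap.lsmul k H) ∘ₗ (counit ∘ₗ LinearMap.mulLeft k h)).flip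
        (comul 1)
  antipode_mul_id_mul_antipode :
    toConv S * (toConv LinearMap.id * toConv S) = toConv S

namespace IsWeakHopf

variable {k H : Type*} [CommRing k] [Ring H] [Algebra k H]

/-- Contraction of the first tensor factor with a linear form. -/
noncomputable def contractFst (φ : H →ₗ[k] k) : H ⊗[k] H →ₗ[k] H :=
  (TensorProduct.lid k H).toLinearMap ∘ₗ φ.rTensor H

/-- Contraction of the second tensor factor with a linear form. -/
noncomputable def contractSnd (φ : H →ₗ[k] k) : H ⊗[k] H →ₗ[k] H :=
  (TensorProduct.rid k H).toLinearMap ∘ₗ φ.lTensor H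

@[simp]
lemma contractFst_tmul (φ : H →ₗ[k] k) (x y : H) : contractFst φ (x ⊗ₜ y) = φ x • y := by
  simp [contractFst]

@[simp]
lemma contractSnd_tmul (φ : H →ₗ[k] k) (x y : H) : contractSnd φ (x ⊗ₜ y) = φ y • x := by
  simp [contractSnd]

/-- The linear map `h ⊗ x ↦ f(hx)`. -/
noncomputable def pullMul (f : WithConv (H →ₗ[k] H)) : WithConv (H ⊗[k] H →ₗ[k] H) :=
  toConv (f.ofConv ∘ₗ LinearMap.mul' k H)

@[simp]
lemma pullMul_tmul (f : WithConv (H →ₗ[k] H)) (h x : H) :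
    (pullMul f).ofConv (h ⊗ₜ x) = f.ofConv (h * x) := by
  simp [pullMul]

lemma ext_tmul {F G : WithConv (H ⊗[k] H →ₗ[k] H)}
    (hFG : ∀ h x, F.ofConv (h ⊗ₜ x) = G.ofConv (h ⊗ₜ x)) : F = G :=
  ofConv_injective (TensorProduct.ext' hFG)

variable [Coalgebra k H]

/-- The linear form `l ↦ ε(hl)`. -/
noncomputable abbrev counitLeft (h : H) : H →ₗ[k] k := counit ∘ₗ LinearMap.mulLeft k h

/-- The linear form `l ↦ ε(lh)`. -/
noncomputable abbrev counitRight (h : H) : H →ₗ[k] k := counit ∘ₗ LinearMap.mulRight k h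

@[simp]
lemma contractSnd_counit (x : H) : contractSnd (k := k) counit (comul x) = x := by
  simp [contractSnd]

@[simp]
lemma contractFst_counit (x : H) : contractFst (k := k) counit (comul x) = x := by
  simp [contractFst]

/-- The target map `h ↦ h₍₁₎S(h₍₂₎)`. -/
noncomputable def target (S : H →ₗ[k] H) : H →ₗ[k] H :=
  LinearMap.mul' k H ∘ₗ TensorProduct.map LinearMap.id S ∘ₗ comul

/-- The source map `h ↦ S(h₍₁₎)h₍₂₎`. -/
noncomputable def source (S : H →ₗ[k] H) : H →ₗ[k] H :=
  LinearMap.mul' k H ∘ₗ TensorProduct.map S LinearMap.id ∘ₗ comul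

/-- The map `h ↦ ε(h1₍₁₎)1₍₂₎`. -/
noncomputable def target' : H →ₗ[k] H where
  toFun h := contractFst (k := k) (counitLeft h) (comul 1)
  map_add' x y := by
    generalize comul (R := k) (1 : H) = z
    induction z with
    | zero => simp
    | add a b ha hb => simp only [map_add, ha, hb]; abel
    | tmul a b => simp [add_mul, add_smul]
  map_smul' r x := by
    generalize comul (R := k) (1 : H) = z
    induction z with
    | zero => simp
    | add a b ha hb => simp only [map_add, ha, hb, smul_add]
    | tmul a b => simp [mul_smul]

/-- The element `1₍₁₎ε(1₍₂₎h)`. -/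
noncomputable def source' (h : H) : H := contractSnd (k := k) (counitRight h) (comul 1)

variable {S : H →ₗ[k] H}

lemma target_eq (hS : IsWeakHopf S) (h : H) :
    target S h = contractFst (k := k) (counitRight h) (comul 1) := by
  refine (hS.id_mul_antipode h).trans ?_
  generalize comul (R := k) (1 : H) = z
  induction z with
  | zero => simp
  | add a b ha hb => simp only [map_add, ha, hb]
  | tmul a b => simp

lemma source_eq (hS : IsWeakHopf S) (h : H) :
    source S h = contractSnd (k := k) (counitLeft h) (comul 1) := by
  refine (hS.antipode_mul_id h).trans ?_
  generalize comul (R := k) (1 : H) = z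
  induction z with
  | zero => simp
  | add a b ha hb => simp only [map_add, ha, hb]
  | tmul a b => simp

/-- `y₍₁₎x ε(hy₍₂₎) = y₍₁₎x₍₁₎ ε(hy₍₂₎x₍₂₎)`. -/
lemma contractSnd_counitLeft_mul (hS : IsWeakHopf S) (h x y : H) :
    contractSnd (k := k) (counitLeft h) (comul y) * x =
      contractSnd (k := k) (counitLeft h) (comul (y * x)) := by
  let G : (H ⊗[k] H) ⊗[k] H →ₗ[k] H :=
    contractSnd (k := k) counit ∘ₗ LinearMap.mulRight k (comul x) ∘ₗ
    (TensorProduct.rid k _).toLinearMap ∘ₗ (counitLeft h).lTensor (H ⊗[k] H)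
  have hleft (z : H ⊗[k] H) :
      G (comul.rTensor H z) = contractSnd (k := k) (counitLeft h) z * x := by
    induction z with
    | zero => simp
    | add a b ha hb => simp only [map_add, ha, hb, add_mul]
    | tmul p q => simp [G, ← hS.comul_mul]
  have hright (z : H ⊗[k] H) :
      G ((TensorProduct.assoc k H H H).symm (comul.lTensor H z)) =
        contractSnd (k := k) (counitLeft h) (z * comul x) := by
    induction z with
    | zero => simp
    | add a b ha hb => simp only [map_add, ha, hb, add_mul]
    | tmul p q =>
      simp only [G, LinearMap.comp_apply, LinearMap.mulRight_apply]
      generalize comul (R := k) x = z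
      induction z with
      | zero => simp
      | add a b ha hb => simp only [map_add, ha, hb, mul_add]
      | tmul u v =>
        have := hS.counit_mul_snd_fst h q v
        simp only [Algebra.TensorProduct.tmul_mul_tmul, contractSnd_tmul, LinearMap.comp_apply,
          LinearMap.mulLeft_apply, ← mul_assoc, this, LinearMap.lTensor_tmul]
        generalize comul (R := k) q = w
        induction w with
        | zero => simp
        | add a b ha hb => simp only [map_add, ha, hb, tmul_add, add_mul, add_smul]
        | tmul a b => simp [smul_smul, mul_comm]
  rw [hS.comul_mul, ← hright, coassoc_symm_apply, hleft]

/-- `h y₍₂₎ ε(y₍₁₎x) = h₍₂₎y₍₂₎ ε(h₍₁₎y₍₁₎x)`. -/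
lemma mul_contractFst_counitRight (hS : IsWeakHopf S) (h x y : H) :
    h * contractFst (k := k) (counitRight x) (comul y) =
      contractFst (k := k) (counitRight x) (comul (h * y)) := by
  let G : H ⊗[k] (H ⊗[k] H) →ₗ[k] H :=
    contractFst (k := k) counit ∘ₗ LinearMap.mulLeft k (comul h) ∘ₗ
    (TensorProduct.lid k _).toLinearMap ∘ₗ (counitRight x).rTensor (H ⊗[k] H)
  have hright (z : H ⊗[k] H) :
      G (comul.lTensor H z) = h * contractFst (k := k) (counitRight x) z := by
    induction z with
    | zero => simp
    | add a b ha hb => simp only [map_add, ha, hb, mul_add]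
    | tmul p q => simp [G, ← hS.comul_mul]
  have hleft (z : H ⊗[k] H) :
      G (TensorProduct.assoc k H H H (comul.rTensor H z)) =
        contractFst (k := k) (counitRight x) (comul h * z) := by
    induction z with
    | zero => simp
    | add a b ha hb => simp only [map_add, ha, hb, mul_add]
    | tmul p q =>
      simp only [G, LinearMap.comp_apply, LinearMap.mulLeft_apply]
      generalize comul (R := k) h = z
      induction z with
      | zero => simp
      | add a b ha hb => simp only [map_add, ha, hb, add_mul]
      | tmul u v =>
        have := hS.counit_mul_snd_fst u p x
        simp only [Algebra.TensorProduct.tmul_mul_tmul, contractFst_tmul, LinearMap.comp_apply,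
          LinearMap.mulRight_apply, this, LinearMap.rTensor_tmul]
        generalize comul (R := k) p = w
        induction w with
        | zero => simp
        | add a b ha hb => simp only [map_add, ha, hb, add_tmul, mul_add, add_smul]
        | tmul a b => simp [smul_smul]
  rw [hS.comul_mul, ← hleft, coassoc_apply, hright]

/-- `h y₍₁₎ ε(y₍₂₎x) = h₍₁₎y₍₁₎ ε(h₍₂₎y₍₂₎x)`. -/
lemma mul_contractSnd_counitRight (hS : IsWeakHopf S) (h x y : H) :
    h * contractSnd (k := k) (counitRight x) (comul y) =
      contractSnd (k := k) (counitRight x) (comul (h * y)) := by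
  let G : (H ⊗[k] H) ⊗[k] H →ₗ[k] H :=
    contractSnd (k := k) counit ∘ₗ LinearMap.mulLeft k (comul h) ∘ₗ
    (TensorProduct.rid k _).toLinearMap ∘ₗ (counitRight x).lTensor (H ⊗[k] H)
  have hleft (z : H ⊗[k] H) :
      G (comul.rTensor H z) = h * contractSnd (k := k) (counitRight x) z := by
    induction z with
    | zero => simp
    | add a b ha hb => simp only [map_add, ha, hb, mul_add]
    | tmul p q => simp [G, ← hS.comul_mul]
  have hright (z : H ⊗[k] H) :
      G ((TensorProduct.assoc k H H H).symm (comul.lTensor H z)) =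
        contractSnd (k := k) (counitRight x) (comul h * z) := by
    induction z with
    | zero => simp
    | add a b ha hb => simp only [map_add, ha, hb, mul_add]
    | tmul p q =>
      simp only [G, LinearMap.comp_apply, LinearMap.mulLeft_apply]
      generalize comul (R := k) h = z
      induction z with
      | zero => simp
      | add a b ha hb => simp only [map_add, ha, hb, add_mul]
      | tmul u v =>
        have := hS.counit_mul_fst_snd v q x
        simp only [Algebra.TensorProduct.tmul_mul_tmul, contractSnd_tmul, LinearMap.comp_apply,
          LinearMap.mulRight_apply, this, LinearMap.lTensor_tmul]
        generalize comul (R := k) q = w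
        induction w with
        | zero => simp
        | add a b ha hb => simp only [map_add, ha, hb, tmul_add, mul_add, add_smul]
        | tmul a b => simp [smul_smul, mul_comm]
  rw [hS.comul_mul, ← hright, coassoc_symm_apply, hleft]

/-- `ε_s(h) x = x₍₁₎ ε(hx₍₂₎)`. -/
lemma source_mul (hS : IsWeakHopf S) (h x : H) :
    source S h * x = contractSnd (k := k) (counitLeft h) (comul x) := by
  rw [hS.source_eq, hS.contractSnd_counitLeft_mul, one_mul]

/-- `h ε_t(x) = ε(h₍₁₎x) h₍₂₎`. -/
lemma mul_target (hS : IsWeakHopf S) (h x : H) :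
    h * target S x = contractFst (k := k) (counitRight x) (comul h) := by
  rw [hS.target_eq, hS.mul_contractFst_counitRight, mul_one]

lemma mul_source' (hS : IsWeakHopf S) (h x : H) :
    h * source' (k := k) x = contractSnd (k := k) (counitRight x) (comul h) := by
  rw [source', hS.mul_contractSnd_counitRight, mul_one]

lemma counit_mul_contractFst (h x : H) (z : H ⊗[k] H) :
    counit (R := k) (h * contractFst (k := k) (counitRight x) z) = LinearMap.mul' k k
      (TensorProduct.map (counitRight x) (counitLeft h) z) := by
  induction z with
  | zero => simp
  | add a b ha hb => simp only [map_add, ha, hb, mul_add]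
  | tmul a b => simp

lemma counit_contractSnd_mul (h x : H) (z : H ⊗[k] H) :
    counit (R := k) (contractSnd (k := k) (counitLeft h) z * x) = LinearMap.mul' k k
      (TensorProduct.map (counitRight x) (counitLeft h) z) := by
  induction z with
  | zero => simp
  | add a b ha hb => simp only [map_add, ha, hb, add_mul]
  | tmul a b => simp [mul_comm]

lemma counit_mul_contractSnd (h x : H) (z : H ⊗[k] H) :
    counit (R := k) (h * contractSnd (k := k) (counitRight x) z) = LinearMap.mul' k k
      (TensorProduct.map (counitLeft h) (counitRight x) z) := by
  induction z with
  | zero => simp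
  | add a b ha hb => simp only [map_add, ha, hb, mul_add]
  | tmul a b => simp [mul_comm]

lemma counit_contractFst_mul (h x : H) (z : H ⊗[k] H) :
    counit (R := k) (contractFst (k := k) (counitLeft h) z * x) = LinearMap.mul' k k
      (TensorProduct.map (counitLeft h) (counitRight x) z) := by
  induction z with
  | zero => simp
  | add a b ha hb => simp only [map_add, ha, hb, add_mul]
  | tmul a b => simp

lemma counit_mul_target (hS : IsWeakHopf S) (h x : H) :
    counit (R := k) (h * target S x) = counit (R := k) (h * x) := by
  rw [hS.target_eq, counit_mul_contractFst, ← hS.counit_mul_snd_fst, mul_one]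

lemma counit_source_mul (hS : IsWeakHopf S) (h x : H) :
    counit (R := k) (source S h * x) = counit (R := k) (h * x) := by
  rw [hS.source_eq, counit_contractSnd_mul, ← hS.counit_mul_snd_fst, mul_one]

lemma counit_mul_source' (hS : IsWeakHopf S) (h x : H) :
    counit (R := k) (h * source' (k := k) x) = counit (R := k) (h * x) := by
  rw [source', counit_mul_contractSnd, ← hS.counit_mul_fst_snd, mul_one]

lemma counit_target'_mul (hS : IsWeakHopf S) (h x : H) :
    counit (R := k) (target' (k := k) h * x) = counit (R := k) (h * x) := by
  change counit (contractFst (k := k) (counitLeft h) (comul 1) * x) = _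
  rw [counit_contractFst_mul, ← hS.counit_mul_fst_snd, mul_one]

lemma target_congr (hS : IsWeakHopf S) {x y : H}
    (h : ∀ z, counit (R := k) (z * x) = counit (R := k) (z * y)) : target S x = target S y := by
  rw [hS.target_eq, hS.target_eq]
  congr 2
  ext z
  exact h z

lemma source_congr (hS : IsWeakHopf S) {x y : H}
    (h : ∀ z, counit (R := k) (x * z) = counit (R := k) (y * z)) : source S x = source S y := by
  rw [hS.source_eq, hS.source_eq]
  congr 2
  ext z
  exact h z

lemma target_target (hS : IsWeakHopf S) (x : H) : target S (target S x) = target S x :=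
  hS.target_congr fun z ↦ hS.counit_mul_target z x

lemma source_source (hS : IsWeakHopf S) (x : H) : source S (source S x) = source S x :=
  hS.source_congr fun z ↦ hS.counit_source_mul x z

lemma target_source' (hS : IsWeakHopf S) (x : H) :
    target S (source' (k := k) x) = target S x :=
  hS.target_congr fun z ↦ hS.counit_mul_source' z x

lemma source_target' (hS : IsWeakHopf S) (x : H) :
    source S (target' (k := k) x) = source S x :=
  hS.source_congr fun z ↦ hS.counit_target'_mul x z

/-- `ε_t(h₍₁₎) h₍₂₎ = h`. -/
lemma target_mul_id (hS : IsWeakHopf S) (h : H) :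
    LinearMap.mul' k H ((target S).rTensor H (comul h)) = h := by
  have key (z : H ⊗[k] H) :
      LinearMap.mul' k H ((target S).rTensor H z) = contractFst (k := k) counit (comul 1 * z) := by
    induction z with
    | zero => simp
    | add a b ha hb => simp only [map_add, ha, hb, mul_add]
    | tmul p q =>
      simp only [LinearMap.rTensor_tmul, LinearMap.mul'_apply, hS.target_eq]
      generalize comul (R := k) (1 : H) = w
      induction w with
      | zero => simp
      | add a b ha hb => simp only [map_add, ha, hb, add_mul]
      | tmul a b => simp
  rw [key, ← hS.comul_mul, one_mul, contractFst_counit]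

/-- `1₍₁₎ ⊗ ε_t(1₍₂₎) = ε_s(1₍₁₎) ⊗ 1₍₂₎`. -/
lemma lTensor_target_comul_one (hS : IsWeakHopf S) :
    (target S).lTensor H (comul 1) = (source S).rTensor H (comul 1) := by
  let r := ℛ k (1 : H)
  rw [← r.eq]
  simp only [map_sum, LinearMap.lTensor_tmul, LinearMap.rTensor_tmul, hS.target_eq, hS.source_eq,
    ← r.eq, contractFst_tmul, contractSnd_tmul, tmul_sum, sum_tmul, tmul_smul, smul_tmul']
  exact Finset.sum_comm

lemma rTensor_source_mul_comul_one (hS : IsWeakHopf S) (x : H) :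
    (source S).rTensor H (comul x) * comul 1 = (source S).rTensor H (comul x) := by
  let m : (H ⊗[k] H) ⊗[k] H →ₗ[k] H ⊗[k] H :=
    (LinearMap.mul' k H ∘ₗ TensorProduct.map S LinearMap.id).rTensor H
  have hm (p : H) (w : H ⊗[k] H) :
      m ((TensorProduct.assoc k H H H).symm (p ⊗ₜ w)) = (S p ⊗ₜ 1) * w := by
    induction w with
    | zero => simp
    | add a b ha hb => simp only [map_add, ha, hb, mul_add, tmul_add]
    | tmul a b => simp [m]
  have key (z : H ⊗[k] H) :
      m ((TensorProduct.assoc k H H H).symm (comul.lTensor H z)) * comul 1 =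
        m ((TensorProduct.assoc k H H H).symm (comul.lTensor H z)) := by
    induction z with
    | zero => simp
    | add a b ha hb => simp only [map_add, ha, hb, add_mul]
    | tmul p q => rw [LinearMap.lTensor_tmul, hm, mul_assoc, ← hS.comul_mul, mul_one]
  have hs : (source S).rTensor H (comul x) =
      m ((TensorProduct.assoc k H H H).symm (comul.lTensor H (comul x))) := by
    rw [coassoc_symm_apply, ← LinearMap.comp_apply (f := m), ← LinearMap.rTensor_comp]
    rfl
  rw [hs, key]

/-- `1₍₁₎x ⊗ ε_t(1₍₂₎) = x₍₁₎ ⊗ ε_t(x₍₂₎)`. -/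
lemma lTensor_target_comul_one_mul (hS : IsWeakHopf S) (x : H) :
    (target S).lTensor H (comul 1) * (x ⊗ₜ 1) = (target S).lTensor H (comul x) := by
  let r := ℛ k (1 : H)
  have key (z : H ⊗[k] H) : (target S).lTensor H z =
      ∑ i ∈ r.index, contractSnd (k := k) (counitLeft (r.left i)) z ⊗ₜ[k] r.right i := by
    induction z with
    | zero => simp
    | add a b ha hb => simp only [map_add, ha, hb, add_tmul, Finset.sum_add_distrib]
    | tmul p q => simp [hS.target_eq, ← r.eq, tmul_sum, smul_tmul]
  rw [key, key, Finset.sum_mul]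
  refine Finset.sum_congr rfl fun i _ ↦ ?_
  rw [Algebra.TensorProduct.tmul_mul_tmul, mul_one, hS.contractSnd_counitLeft_mul, one_mul]

lemma lTensor_target_mul_comul_one (hS : IsWeakHopf S) :
    (target S).lTensor H (comul 1) * comul 1 = comul (R := k) (1 : H) := by
  let m : (H ⊗[k] H) ⊗[k] H →ₗ[k] H ⊗[k] H :=
    (LinearMap.mul' k H ∘ₗ (target S).rTensor H).lTensor H ∘ₗ (TensorProduct.assoc k H H H)
  have hm (w : H ⊗[k] H) (q : H) : m (w ⊗ₜ q) = (target S).lTensor H w * (1 ⊗ₜ q) := by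
    induction w with
    | zero => simp
    | add a b ha hb => simp only [map_add, ha, hb, add_mul, add_tmul]
    | tmul a b => simp [m]
  have key (z : H ⊗[k] H) :
      (target S).lTensor H (comul 1) * z = m (comul.rTensor H z) := by
    induction z with
    | zero => simp
    | add a b ha hb => simp only [map_add, ha, hb, mul_add]
    | tmul p q =>
      rw [LinearMap.rTensor_tmul, hm, ← hS.lTensor_target_comul_one_mul p, mul_assoc]
      simp
  have hid : LinearMap.mul' k H ∘ₗ (target S).rTensor H ∘ₗ comul = LinearMap.id :=
    LinearMap.ext hS.target_mul_id
  rw [key]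
  simp only [m, LinearMap.comp_apply, LinearEquiv.coe_coe, coassoc_apply]
  rw [← LinearMap.comp_apply, ← LinearMap.lTensor_comp, LinearMap.comp_assoc, hid,
    LinearMap.lTensor_id, LinearMap.id_apply]

lemma rTensor_source_comul_one (hS : IsWeakHopf S) :
    (source S).rTensor H (comul 1) = comul (R := k) (1 : H) := by
  rw [← hS.rTensor_source_mul_comul_one, ← hS.lTensor_target_comul_one,
    hS.lTensor_target_mul_comul_one]

lemma lTensor_target_comul_one' (hS : IsWeakHopf S) :
    (target S).lTensor H (comul 1) = comul (R := k) (1 : H) := by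
  rw [hS.lTensor_target_comul_one, hS.rTensor_source_comul_one]

lemma comul_target (hS : IsWeakHopf S) (w : H) :
    comul (R := k) (target S w) = comul 1 * (target S w ⊗ₜ 1) := by
  let G : H ⊗[k] (H ⊗[k] H) →ₗ[k] H ⊗[k] H :=
    (TensorProduct.lid k _).toLinearMap ∘ₗ (counitRight w).rTensor (H ⊗[k] H)
  have hG (z : H ⊗[k] H) :
      G (comul.lTensor H z) = comul (contractFst (k := k) (counitRight w) z) := by
    induction z with
    | zero => simp
    | add a b ha hb => simp only [map_add, ha, hb]
    | tmul p q => simp [G]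
  have hG' (z : H ⊗[k] (H ⊗[k] H)) :
      (target S).lTensor H (G z) = G (((target S).lTensor H).lTensor H z) := by
    induction z with
    | zero => simp
    | add a b ha hb => simp only [map_add, ha, hb]
    | tmul p q => simp [G]
  have hassoc (z : H ⊗[k] H) : ((target S).lTensor H).lTensor H
      (TensorProduct.assoc k H H H (comul.rTensor H z)) =
      TensorProduct.assoc k H H H (comul.rTensor H ((target S).lTensor H z)) := by
    induction z with
    | zero => simp
    | add a b ha hb => simp only [map_add, ha, hb]
    | tmul p q =>
      simp only [LinearMap.rTensor_tmul, LinearMap.lTensor_tmul]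
      generalize comul (R := k) p = u
      induction u with
      | zero => simp
      | add a b ha hb => simp only [map_add, ha, hb, add_tmul]
      | tmul a b => simp
  rw [← hS.lTensor_target_comul_one', hS.lTensor_target_comul_one_mul, hS.target_eq, ← hG, hG',
    ← coassoc_apply, hassoc, hS.lTensor_target_comul_one']

lemma target_mul_source' (hS : IsWeakHopf S) (w x : H) :
    target S w * source' (k := k) x = source' (k := k) x * target S w := by
  rw [hS.mul_source', hS.comul_target, source']
  generalize comul (R := k) (1 : H) = z
  induction z with
  | zero => simp
  | add a b ha hb => simp only [map_add, ha, hb, add_mul]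
  | tmul p q => simp

lemma source_source'_self (hS : IsWeakHopf S) (x : H) :
    source S (source' (k := k) x) = source' (k := k) x := by
  have key (z : H ⊗[k] H) : source S (contractSnd (k := k) (counitRight x) z) =
      contractSnd (k := k) (counitRight x) ((source S).rTensor H z) := by
    induction z with
    | zero => simp
    | add a b ha hb => simp only [map_add, ha, hb]
    | tmul p q => simp
  rw [source', key, hS.rTensor_source_comul_one]

lemma target_target'_self (hS : IsWeakHopf S) (x : H) :
    target S (target' (k := k) x) = target' (k := k) x := by
  have key (z : H ⊗[k] H) : target S (contractFst (k := k) (counitLeft x) z) =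
      contractFst (k := k) (counitLeft x) ((target S).lTensor H z) := by
    induction z with
    | zero => simp
    | add a b ha hb => simp only [map_add, ha, hb]
    | tmul p q => simp
  change target S (contractFst (k := k) (counitLeft x) (comul 1)) =
    contractFst (k := k) (counitLeft x) (comul 1)
  rw [key, hS.lTensor_target_comul_one']

lemma finite_range_target (hS : IsWeakHopf S) :
    Module.Finite k (LinearMap.range (target S)) := by
  let r := ℛ k (1 : H)
  refine Module.Finite.iff_fg.mpr (Submodule.fg_def.mpr
    ⟨(fun i ↦ target S (r.right i)) '' r.index, r.index.finite_toSet.image _, ?_⟩)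
  apply le_antisymm
  · rw [Submodule.span_le]
    rintro _ ⟨i, _, rfl⟩
    exact ⟨_, rfl⟩
  · rintro _ ⟨x, rfl⟩
    rw [← hS.target_target, hS.target_eq x, ← r.eq, map_sum, map_sum]
    refine Submodule.sum_mem _ fun i hi ↦ ?_
    rw [contractFst_tmul, map_smul]
    exact Submodule.smul_mem _ _ (Submodule.subset_span ⟨i, hi, rfl⟩)

lemma injOn_target_range_source (hS : IsWeakHopf S) :
    Function.Injective ((target S).rangeRestrict ∘ₗ (LinearMap.range (source S)).subtype) := by
  have := hS.finite_range_target
  refine OrzechProperty.injective_of_surjective_of_injective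
    ((target' (k := k) (H := H) ∘ₗ (LinearMap.range (source S)).subtype).codRestrict
      (LinearMap.range (target S)) fun x ↦ ⟨_, hS.target_target'_self x⟩) _ ?_ ?_
  · rintro ⟨_, x, rfl⟩ ⟨_, y, rfl⟩ h
    have h' : source S (target' (k := k) (source S x)) =
        source S (target' (k := k) (source S y)) := congrArg (fun z ↦ source S z.1) h
    exact Subtype.ext (by simpa only [hS.source_target', hS.source_source] using h')
  · rintro ⟨_, x, rfl⟩
    exact ⟨⟨source' (k := k) x, _, hS.source_source'_self x⟩, Subtype.ext (hS.target_source' x)⟩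

lemma source'_source (hS : IsWeakHopf S) (x : H) :
    source' (k := k) (source S x) = source S x := by
  have := hS.injOn_target_range_source (a₁ := ⟨_, _, hS.source_source'_self (source S x)⟩)
    (a₂ := ⟨_, x, rfl⟩) (Subtype.ext (hS.target_source' _))
  exact congrArg Subtype.val this

lemma target_mul_source (hS : IsWeakHopf S) (h c : H) :
    target S h * source S c = source S c * target S h := by
  rw [← hS.source'_source c, hS.target_mul_source']

/-- The linear map `h ⊗ x ↦ ε(x) f(h)`. -/
noncomputable def pullFst (f : WithConv (H →ₗ[k] H)) : WithConv (H ⊗[k] H →ₗ[k] H) :=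
  toConv ((TensorProduct.rid k H).toLinearMap ∘ₗ TensorProduct.map f.ofConv counit)

/-- The linear map `h ⊗ x ↦ ε(h) f(x)`. -/
noncomputable def pullSnd (f : WithConv (H →ₗ[k] H)) : WithConv (H ⊗[k] H →ₗ[k] H) :=
  toConv ((TensorProduct.lid k H).toLinearMap ∘ₗ TensorProduct.map counit f.ofConv)

/-- The linear map `h ⊗ x ↦ ε(hx) 1`. -/
noncomputable def counitMul : WithConv (H ⊗[k] H →ₗ[k] H) :=
  toConv (Algebra.linearMap k H ∘ₗ counit ∘ₗ LinearMap.mul' k H)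

@[simp]
lemma pullFst_tmul (f : WithConv (H →ₗ[k] H)) (h x : H) :
    (pullFst f).ofConv (h ⊗ₜ x) = counit (R := k) x • f.ofConv h := by
  simp [pullFst]

@[simp]
lemma pullSnd_tmul (f : WithConv (H →ₗ[k] H)) (h x : H) :
    (pullSnd f).ofConv (h ⊗ₜ x) = counit (R := k) h • f.ofConv x := by
  simp [pullSnd]

@[simp]
lemma counitMul_tmul (h x : H) :
    (counitMul (k := k)).ofConv (h ⊗ₜ x) = counit (R := k) (h * x) • (1 : H) := by
  simp [counitMul, Algebra.algebraMap_eq_smul_one]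

lemma convMul_tmul (F G : WithConv (H ⊗[k] H →ₗ[k] H)) {h x : H}
    (r : Coalgebra.Repr k h (H × H)) (q : Coalgebra.Repr k x (H × H)) :
    (F * G).ofConv (h ⊗ₜ x) = ∑ i ∈ r.index, ∑ j ∈ q.index,
      F.ofConv (r.left i ⊗ₜ q.left j) * G.ofConv (r.right i ⊗ₜ q.right j) := by
  rw [Finset.sum_comm]
  simp [LinearMap.convMul_def, TensorProduct.comul_tmul, ← r.eq, ← q.eq, tmul_sum, sum_tmul]

lemma convMul_pullFst_tmul (F : WithConv (H ⊗[k] H →ₗ[k] H)) (g : WithConv (H →ₗ[k] H)) {h : H}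
    (r : Coalgebra.Repr k h (H × H)) (x : H) :
    (F * pullFst g).ofConv (h ⊗ₜ x) =
      ∑ i ∈ r.index, F.ofConv (r.left i ⊗ₜ x) * g.ofConv (r.right i) := by
  rw [convMul_tmul F _ r (ℛ k x)]
  refine Finset.sum_congr rfl fun i _ ↦ ?_
  conv_rhs => rw [← contractSnd_counit (k := k) x, ← (ℛ k x).eq]
  simp [tmul_sum, Finset.sum_mul]

lemma pullSnd_convMul_tmul (F : WithConv (H ⊗[k] H →ₗ[k] H)) (g : WithConv (H →ₗ[k] H)) (h : H)
    {x : H} (q : Coalgebra.Repr k x (H × H)) :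
    (pullSnd g * F).ofConv (h ⊗ₜ x) =
      ∑ j ∈ q.index, g.ofConv (q.left j) * F.ofConv (h ⊗ₜ q.right j) := by
  rw [convMul_tmul _ F (ℛ k h) q, Finset.sum_comm]
  refine Finset.sum_congr rfl fun i _ ↦ ?_
  conv_rhs => rw [← contractFst_counit (k := k) h, ← (ℛ k h).eq]
  simp [sum_tmul, Finset.mul_sum, ← smul_tmul']

lemma convMul_eq_sum (f g : WithConv (H →ₗ[k] H)) {h : H} (r : Coalgebra.Repr k h (H × H)) :
    (f * g).ofConv h = ∑ i ∈ r.index, f.ofConv (r.left i) * g.ofConv (r.right i) :=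
  r.convMul_apply f g

lemma pullFst_convMul_pullFst (f g : WithConv (H →ₗ[k] H)) :
    pullFst f * pullFst g = pullFst (f * g) := by
  refine ext_tmul fun h x ↦ ?_
  rw [convMul_pullFst_tmul _ g (ℛ k h) x, pullFst_tmul, convMul_eq_sum f g (ℛ k h)]
  simp [Finset.smul_sum]

lemma pullSnd_convMul_pullSnd (f g : WithConv (H →ₗ[k] H)) :
    pullSnd f * pullSnd g = pullSnd (f * g) := by
  refine ext_tmul fun h x ↦ ?_
  rw [pullSnd_convMul_tmul _ f h (ℛ k x), pullSnd_tmul, convMul_eq_sum f g (ℛ k x)]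
  simp [Finset.smul_sum]

lemma pullFst_convMul_pullSnd_tmul (f g : WithConv (H →ₗ[k] H)) (h x : H) :
    (pullFst f * pullSnd g).ofConv (h ⊗ₜ x) = f.ofConv h * g.ofConv x := by
  rw [convMul_tmul _ _ (ℛ k h) (ℛ k x)]
  conv_rhs => rw [← contractSnd_counit (k := k) h, ← (ℛ k h).eq,
    ← contractFst_counit (k := k) x, ← (ℛ k x).eq]
  simp only [map_sum, contractSnd_tmul, contractFst_tmul, map_smul, Finset.sum_mul_sum,
    pullFst_tmul, pullSnd_tmul, smul_mul_smul_comm, mul_comm]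

lemma pullSnd_convMul_pullFst_tmul (f g : WithConv (H →ₗ[k] H)) (h x : H) :
    (pullSnd f * pullFst g).ofConv (h ⊗ₜ x) = f.ofConv x * g.ofConv h := by
  rw [pullSnd_convMul_tmul _ f h (ℛ k x)]
  conv_rhs => rw [← contractSnd_counit (k := k) x, ← (ℛ k x).eq]
  simp [Finset.sum_mul]

lemma pullMul_convMul_pullMul (hS : IsWeakHopf S) (f g : WithConv (H →ₗ[k] H)) :
    pullMul f * pullMul g = pullMul (f * g) := by
  refine ext_tmul fun h x ↦ ?_
  rw [convMul_tmul _ _ (ℛ k h) (ℛ k x), pullMul_tmul, LinearMap.convMul_def, ofConv_toConv,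
    LinearMap.comp_apply, LinearMap.comp_apply, hS.comul_mul, ← (ℛ k h).eq, ← (ℛ k x).eq]
  simp [Finset.sum_mul_sum]

lemma ofConv_id_mul_antipode (S : H →ₗ[k] H) :
    (toConv LinearMap.id * toConv S).ofConv = target S := rfl

lemma ofConv_antipode_mul_id (S : H →ₗ[k] H) :
    (toConv S * toConv LinearMap.id).ofConv = source S := rfl

lemma id_mul_antipode_mul_id (hS : IsWeakHopf S) :
    toConv LinearMap.id * toConv S * toConv LinearMap.id = toConv (LinearMap.id (R := k) (M := H)) :=
  ofConv_injective (LinearMap.ext hS.target_mul_id)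

/-- `h ε_t(x) = ε(h₍₁₎x) h₍₂₎` as an identity of convolution products. -/
lemma pullFst_mul_pullSnd_mul (hS : IsWeakHopf S) :
    pullFst (toConv LinearMap.id) * pullSnd (toConv LinearMap.id * toConv S) =
      counitMul (k := k) * pullFst (toConv LinearMap.id) := by
  refine ext_tmul fun h x ↦ ?_
  rw [pullFst_convMul_pullSnd_tmul, convMul_pullFst_tmul _ _ (ℛ k h), ofConv_id_mul_antipode,
    ofConv_toConv, LinearMap.id_apply, hS.mul_target]
  conv_lhs => rw [← (ℛ k h).eq]
  simp

/-- `ε_s(h) x = x₍₁₎ ε(hx₍₂₎)` as an identity of convolution products. -/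
lemma pullFst_mul_mul_pullSnd (hS : IsWeakHopf S) :
    pullFst (toConv S * toConv LinearMap.id) * pullSnd (toConv LinearMap.id) =
      pullSnd (toConv LinearMap.id) * counitMul (k := k) := by
  refine ext_tmul fun h x ↦ ?_
  rw [pullFst_convMul_pullSnd_tmul, pullSnd_convMul_tmul _ _ _ (ℛ k x), ofConv_antipode_mul_id,
    ofConv_toConv, LinearMap.id_apply, hS.source_mul]
  conv_lhs => rw [← (ℛ k x).eq]
  simp

/-- `ε_t(hx) = ε(h₍₁₎x) ε_t(h₍₂₎)` as an identity of convolution products. -/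
lemma counitMul_mul_pullFst (hS : IsWeakHopf S) :
    counitMul (k := k) * pullFst (toConv LinearMap.id * toConv S) =
      pullMul (toConv LinearMap.id * toConv S) := by
  refine ext_tmul fun h x ↦ ?_
  have ht : target S (h * x) = target S (h * target S x) := hS.target_congr fun z ↦ by
    rw [← mul_assoc, ← mul_assoc, hS.counit_mul_target]
  rw [convMul_pullFst_tmul _ _ (ℛ k h), pullMul_tmul, ofConv_id_mul_antipode, ht, hS.mul_target]
  conv_rhs => rw [← (ℛ k h).eq]
  simp

/-- `ε_s(hx) = ε_s(x₍₁₎) ε(hx₍₂₎)` as an identity of convolution products. -/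
lemma pullSnd_mul_counitMul (hS : IsWeakHopf S) :
    pullSnd (toConv S * toConv LinearMap.id) * counitMul (k := k) =
      pullMul (toConv S * toConv LinearMap.id) := by
  refine ext_tmul fun h x ↦ ?_
  have hs : source S (h * x) = source S (source S h * x) := hS.source_congr fun z ↦ by
    rw [mul_assoc, mul_assoc, hS.counit_source_mul]
  rw [pullSnd_convMul_tmul _ _ _ (ℛ k x), pullMul_tmul, ofConv_antipode_mul_id, hs, hS.source_mul]
  conv_rhs => rw [← (ℛ k x).eq]
  simp

lemma pullFst_mul_pullSnd_comm (hS : IsWeakHopf S) :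
    pullFst (toConv S * toConv LinearMap.id) * pullSnd (toConv LinearMap.id * toConv S) =
      pullSnd (toConv LinearMap.id * toConv S) * pullFst (toConv S * toConv LinearMap.id) := by
  refine ext_tmul fun h x ↦ ?_
  rw [pullFst_convMul_pullSnd_tmul, pullSnd_convMul_pullFst_tmul, ofConv_id_mul_antipode,
    ofConv_antipode_mul_id, hS.target_mul_source]

lemma antipode_mul (hS : IsWeakHopf S) (x y : H) : S (x * y) = S y * S x := by
  have hI := pullFst_mul_pullSnd_mul hS
  have hJ := pullFst_mul_mul_pullSnd hS
  have ht := counitMul_mul_pullFst hS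
  have hs := pullSnd_mul_counitMul hS
  have hcomm := pullFst_mul_pullSnd_comm hS
  have hSIS := hS.antipode_mul_id_mul_antipode
  have ha := congrArg pullFst hSIS
  have hb := congrArg pullSnd hSIS
  have hc := congrArg pullMul hSIS
  have hab : pullMul (toConv LinearMap.id) =
      pullFst (toConv LinearMap.id) * pullSnd (toConv (LinearMap.id (R := k) (M := H))) :=
    ext_tmul fun h x ↦ by simp only [pullFst_convMul_pullSnd_tmul, pullMul_tmul]; rfl
  simp only [← pullFst_convMul_pullFst, ← pullSnd_convMul_pullSnd,
    ← hS.pullMul_convMul_pullMul] at hI hJ ht hs hcomm ha hb hc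
  rw [hab] at ht hs hc
  suffices h : pullSnd (toConv S) * pullFst (toConv S) = pullMul (toConv S) by
    have := congrArg (fun F ↦ F.ofConv (x ⊗ₜ y)) h
    simpa only [pullSnd_convMul_pullFst_tmul, pullMul_tmul] using this.symm
  generalize pullFst (toConv (LinearMap.id (R := k) (M := H))) = a at *
  generalize pullSnd (toConv (LinearMap.id (R := k) (M := H))) = b at *
  generalize pullFst (toConv S) = a' at *
  generalize pullSnd (toConv S) = b' at *
  generalize pullMul (toConv S) = c' at *
  generalize counitMul (k := k) (H := H) = η at *
  have hcd : a * b * (b' * a') = a * b * c' := by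
    rw [← ht, ← mul_assoc η, ← hI]
    simp only [mul_assoc]
  have hdc : b' * a' * (a * b) = c' * (a * b) := by
    rw [← hs, mul_assoc b' b, ← hJ]
    simp only [mul_assoc]
  calc b' * a' = b' * (b * b') * (a' * a * a') := by rw [hb, mul_assoc, ha]
    _ = b' * (b * b' * (a' * a)) * a' := by simp only [mul_assoc]
    _ = b' * a' * (a * b) * (b' * a') := by rw [← hcomm]; simp only [mul_assoc]
    _ = c' := by rw [hdc, mul_assoc, hcd, hc]

end IsWeakHopf

end WeakHopf

/-- **Weak Hopf algebras are quantum inverse semigroups.**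
Let `H` be a weak Hopf algebra over `k`: a unital algebra and coalgebra with
multiplicative `Δ` (not necessarily unital), counit satisfying
`ε(hcl) = ε(hc₍₁₎)ε(c₍₂₎l) = ε(hc₍₂₎)ε(c₍₁₎l)`, and antipode `S` with
`h₍₁₎S(h₍₂₎) = ε(1₍₁₎h)1₍₂₎`, `S(h₍₁₎)h₍₂₎ = 1₍₁₎ε(h1₍₂₎)` and
`S(h₍₁₎)h₍₂₎S(h₍₃₎) = S(h)`.  Then `h₍₁₎S(h₍₂₎)h₍₃₎ = h` for all `h`, the elements
`h₍₁₎S(h₍₂₎)` and `S(c₍₁₎)c₍₂₎` commute, and consequently `H` is a QISG: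
`S` is antimultiplicative and `I∗S∗I = I`, `S∗I∗S = S` in convolution. -/
theorem weakHopfAlgebra_is_QISG {k H : Type*} [CommRing k] [Ring H] [Algebra k H]
    (Δ : H →ₗ[k] H ⊗[k] H) (ε : H →ₗ[k] k) (S : H →ₗ[k] H)
    (hΔmul : ∀ x y : H, Δ (x * y) = Δ x * Δ y)
    (hcoassoc :
      (TensorProduct.assoc k H H H).toLinearMap ∘ₗ (TensorProduct.map Δ LinearMap.id) ∘ₗ Δ
        = (TensorProduct.map LinearMap.id Δ) ∘ₗ Δ)
    (hcounit_l : (TensorProduct.lid k H).toLinearMap ∘ₗ (TensorProduct.map ε LinearMap.id) ∘ₗ Δ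
        = LinearMap.id)
    (hcounit_r : (TensorProduct.rid k H).toLinearMap ∘ₗ (TensorProduct.map LinearMap.id ε) ∘ₗ Δ
        = LinearMap.id)
    -- weak multiplicativity of the counit: `ε(hcl) = ε(hc₍₁₎)ε(c₍₂₎l)`
    (hweakε1 : ∀ h c l : H, ε (h * c * l) =
      LinearMap.mul' k k ((TensorProduct.map (ε ∘ₗ LinearMap.mulLeft k h)
        (ε ∘ₗ LinearMap.mulRight k l)) (Δ c)))
    -- and `ε(hcl) = ε(hc₍₂₎)ε(c₍₁₎l)`
    (hweakε2 : ∀ h c l : H, ε (h * c * l) =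
      LinearMap.mul' k k ((TensorProduct.map (ε ∘ₗ LinearMap.mulRight k l)
        (ε ∘ₗ LinearMap.mulLeft k h)) (Δ c)))
    -- `h₍₁₎S(h₍₂₎) = ε(1₍₁₎h)1₍₂₎`
    (hS1 : ∀ h : H,
      LinearMap.mul' k H ((TensorProduct.map LinearMap.id S) (Δ h)) =
        TensorProduct.lift ((LinearMap.lsmul k H) ∘ₗ (ε ∘ₗ LinearMap.mulRight k h)) (Δ 1))
    -- `S(h₍₁₎)h₍₂₎ = 1₍₁₎ε(h1₍₂₎)`
    (hS2 : ∀ h : H,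
      LinearMap.mul' k H ((TensorProduct.map S LinearMap.id) (Δ h)) =
        TensorProduct.lift ((LinearMap.lsmul k H) ∘ₗ (ε ∘ₗ LinearMap.mulLeft k h)).flip (Δ 1))
    -- `S(h₍₁₎)h₍₂₎S(h₍₃₎) = S(h)`
    (hS3 : (LinearMap.mul' k H) ∘ₗ
        (TensorProduct.map S ((LinearMap.mul' k H) ∘ₗ (TensorProduct.map LinearMap.id S) ∘ₗ Δ))
        ∘ₗ Δ = S) :
    -- conclusion: `h₍₁₎S(h₍₂₎)h₍₃₎ = h`
    ((LinearMap.mul' k H) ∘ₗ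
        (TensorProduct.map LinearMap.id ((LinearMap.mul' k H) ∘ₗ
          (TensorProduct.map S LinearMap.id) ∘ₗ Δ)) ∘ₗ Δ = LinearMap.id) ∧
    -- `h₍₁₎S(h₍₂₎)` and `S(c₍₁₎)c₍₂₎` commute
    (∀ h c : H,
      LinearMap.mul' k H ((TensorProduct.map LinearMap.id S) (Δ h)) *
        LinearMap.mul' k H ((TensorProduct.map S LinearMap.id) (Δ c)) =
      LinearMap.mul' k H ((TensorProduct.map S LinearMap.id) (Δ c)) *
        LinearMap.mul' k H ((TensorProduct.map LinearMap.id S) (Δ h))) ∧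
    -- `S` is antimultiplicative
    (∀ x y : H, S (x * y) = S y * S x) ∧
    -- `I∗S∗I = I` and `S∗I∗S = S`
    convProd Δ (convProd Δ LinearMap.id S) LinearMap.id = LinearMap.id ∧
    convProd Δ (convProd Δ S LinearMap.id) S = S := by
  let : Coalgebra k H :=
    { comul := Δ
      counit := ε
      coassoc := hcoassoc
      rTensor_counit_comp_comul := LinearMap.ext fun x ↦ by
        rw [TensorProduct.mk_apply, ← TensorProduct.lid_symm_apply, LinearEquiv.eq_symm_apply]
        exact LinearMap.congr_fun hcounit_l x
      lTensor_counit_comp_comul := LinearMap.ext fun x ↦ by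
        rw [LinearMap.flip_apply, TensorProduct.mk_apply, ← TensorProduct.rid_symm_apply,
          LinearEquiv.eq_symm_apply]
        exact LinearMap.congr_fun hcounit_r x }
  have hS : IsWeakHopf S :=
    ⟨hΔmul, hweakε1, hweakε2, hS1, hS2, congrArg WithConv.toConv hS3⟩
  refine ⟨?_, hS.target_mul_source, hS.antipode_mul, ?_, ?_⟩
  · have h := hS.id_mul_antipode_mul_id
    rw [mul_assoc] at h
    exact congrArg WithConv.ofConv h
  · exact congrArg WithConv.ofConv hS.id_mul_antipode_mul_id
  · have h := hS.antipode_mul_id_mul_antipode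
    rw [← mul_assoc] at h
    exact congrArg WithConv.ofConv h
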